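/- Let (g, [·,·,·], α, β) be a 3-BiHom-Lie superalgebra. If D is a homogeneous (α^s, β^r)-derivation of g and D' is a homogeneous (α^{s'}, β^{r'})-derivation of g, then the supercommutator [D, D'] = D∘D' - (-1)^{|D||D'|} D'∘D is an (α^{s+s'}, β^{r+r'})-derivation of g. -/

import Mathlib

namespace BiHomLieSuper

/-- The sign `(-1)^n` for a parity `n : ZMod 2`. -/
def sg (K : Type*) [Field K] (n : ZMod 2) : K := if n = 0 then 1 else -1

variable (K : Type*) {V : Type*} [Field K] [AddCommGroup V] [Module K V]

/-- `f : V → V → V` is bilinear. -/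
structure IsBilinear (f : V → V → V) : Prop where
  add_left : ∀ x x' y : V, f (x + x') y = f x y + f x' y
  smul_left : ∀ (c : K) (x y : V), f (c • x) y = c • f x y
  add_right : ∀ x y y' : V, f x (y + y') = f x y + f x y'
  smul_right : ∀ (c : K) (x y : V), f x (c • y) = c • f x y

/-- `f : V → V → V → V` is trilinear. -/
structure IsTrilinear (f : V → V → V → V) : Prop where
  add₁ : ∀ x x' y z : V, f (x + x') y z = f x y z + f x' y z
  smul₁ : ∀ (c : K) (x y z : V), f (c • x) y z = c • f x y z
  add₂ : ∀ x y y' z : V, f x (y + y') z = f x y z + f x y' z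
  smul₂ : ∀ (c : K) (x y z : V), f x (c • y) z = c • f x y z
  add₃ : ∀ x y z z' : V, f x y (z + z') = f x y z + f x y z'
  smul₃ : ∀ (c : K) (x y z : V), f x y (c • z) = c • f x y z

/-- An even linear map preserves the `ZMod 2`-grading. -/
def IsEvenMap (G : ZMod 2 → Submodule K V) (φ : Module.End K V) : Prop :=
  ∀ (i : ZMod 2), ∀ x ∈ G i, φ x ∈ G i

/-- A homogeneous linear map of degree `d` with respect to the grading `G`. -/
def IsHomogeneousMap (G : ZMod 2 → Submodule K V) (d : ZMod 2) (D : Module.End K V) : Prop :=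
  ∀ (i : ZMod 2), ∀ x ∈ G i, D x ∈ G (i + d)

/-- A nonmultiplicative BiHom-Lie superalgebra structure on the `ZMod 2`-graded
vector space `V` (grading `G`), with bracket `br` and structure maps `α`, `β`. -/
structure IsNonMultBiHomLieSuperalgebra (G : ZMod 2 → Submodule K V)
    (br : V → V → V) (α β : Module.End K V) : Prop where
  internal : DirectSum.IsInternal G
  bilinear : IsBilinear K br
  br_even : ∀ (i j : ZMod 2), ∀ x ∈ G i, ∀ y ∈ G j, br x y ∈ G (i + j)
  alpha_even : IsEvenMap K G α
  beta_even : IsEvenMap K G β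
  skew : ∀ (i j : ZMod 2), ∀ x ∈ G i, ∀ y ∈ G j,
    br (β x) (α y) = - sg K (i * j) • br (β y) (α x)
  jacobi : ∀ (i j k : ZMod 2), ∀ x ∈ G i, ∀ y ∈ G j, ∀ z ∈ G k,
    sg K (i * k) • br (β (β x)) (br (β y) (α z))
      + sg K (j * i) • br (β (β y)) (br (β z) (α x))
      + sg K (k * j) • br (β (β z)) (br (β x) (α y)) = 0

/-- A (multiplicative) BiHom-Lie superalgebra. -/
structure IsBiHomLieSuperalgebra (G : ZMod 2 → Submodule K V)
    (br : V → V → V) (α β : Module.End K V)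
    extends IsNonMultBiHomLieSuperalgebra K G br α β : Prop where
  comm : α * β = β * α
  alpha_br : ∀ x y : V, α (br x y) = br (α x) (α y)
  beta_br : ∀ x y : V, β (br x y) = br (β x) (β y)

/-- A nonmultiplicative 3-BiHom-Lie superalgebra structure. -/
structure IsNonMult3BiHomLieSuperalgebra (G : ZMod 2 → Submodule K V)
    (br : V → V → V → V) (α β : Module.End K V) : Prop where
  internal : DirectSum.IsInternal G
  trilinear : IsTrilinear K br
  br_even : ∀ (i j k : ZMod 2), ∀ x ∈ G i, ∀ y ∈ G j, ∀ z ∈ G k, br x y z ∈ G (i + j + k)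
  alpha_even : IsEvenMap K G α
  beta_even : IsEvenMap K G β
  skew₁ : ∀ (i j k : ZMod 2), ∀ x ∈ G i, ∀ y ∈ G j, ∀ z ∈ G k,
    br (β x) (β y) (α z) = - sg K (i * j) • br (β y) (β x) (α z)
  skew₂ : ∀ (i j k : ZMod 2), ∀ x ∈ G i, ∀ y ∈ G j, ∀ z ∈ G k,
    br (β x) (β y) (α z) = - sg K (j * k) • br (β x) (β z) (α y)
  jacobi : ∀ (i j k l m : ZMod 2), ∀ x ∈ G i, ∀ y ∈ G j, ∀ z ∈ G k, ∀ u ∈ G l, ∀ v ∈ G m,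
    br (β (β x)) (β (β y)) (br (β z) (β u) (α v))
      = sg K ((l + m) * (i + j + k)) • br (β (β u)) (β (β v)) (br (β x) (β y) (α z))
        - sg K ((k + m) * (i + j) + l * m) • br (β (β z)) (β (β v)) (br (β x) (β y) (α u))
        + sg K ((k + l) * (i + j)) • br (β (β z)) (β (β u)) (br (β x) (β y) (α v))

/-- A (multiplicative) 3-BiHom-Lie superalgebra. -/
structure Is3BiHomLieSuperalgebra (G : ZMod 2 → Submodule K V)
    (br : V → V → V → V) (α β : Module.End K V)
    extends IsNonMult3BiHomLieSuperalgebra K G br α β : Prop where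
  comm : α * β = β * α
  alpha_br : ∀ x y z : V, α (br x y z) = br (α x) (α y) (α z)
  beta_br : ∀ x y z : V, β (br x y z) = br (β x) (β y) (β z)

/-- A 3-Lie superalgebra structure (no structure maps). -/
structure Is3LieSuperalgebra (G : ZMod 2 → Submodule K V)
    (br : V → V → V → V) : Prop where
  internal : DirectSum.IsInternal G
  trilinear : IsTrilinear K br
  br_even : ∀ (i j k : ZMod 2), ∀ x ∈ G i, ∀ y ∈ G j, ∀ z ∈ G k, br x y z ∈ G (i + j + k)
  skew₁ : ∀ (i j k : ZMod 2), ∀ x ∈ G i, ∀ y ∈ G j, ∀ z ∈ G k,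
    br x y z = - sg K (i * j) • br y x z
  skew₂ : ∀ (i j k : ZMod 2), ∀ x ∈ G i, ∀ y ∈ G j, ∀ z ∈ G k,
    br x y z = - sg K (j * k) • br x z y
  jacobi : ∀ (i j k l m : ZMod 2), ∀ x ∈ G i, ∀ y ∈ G j, ∀ z ∈ G k, ∀ u ∈ G l, ∀ v ∈ G m,
    br x y (br z u v) = br (br x y z) u v + sg K (k * (i + j)) • br z (br x y u) v
      + sg K ((k + l) * (i + j)) • br z u (br x y v)

/-- The compatibility conditions on the even linear form `τ` used to induce a
ternary bracket from a binary one: `τ` vanishes on the odd part, `τ([x,y]) = 0`,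
`τ(x)τ(β(y)) = τ(y)τ(β(x))` and `τ(α(x))β(y) = τ(β(x))α(y)`. -/
def TauCompatible (G : ZMod 2 → Submodule K V) (br : V → V → V)
    (α β : Module.End K V) (τ : V →ₗ[K] K) : Prop :=
  (∀ x ∈ G 1, τ x = 0) ∧ (∀ x y : V, τ (br x y) = 0) ∧
  (∀ x y : V, τ x * τ (β y) = τ y * τ (β x)) ∧
  (∀ x y : V, τ (α x) • β y = τ (β x) • α y)

/-- `brτ` is the trilinear bracket induced by `τ` from the binary bracket `br`:
on homogeneous elements it is given by
`[x,y,z]_τ = τ(x)[y,z] - (-1)^{|x||y|} τ(y)[x,z] + (-1)^{|z|(|x|+|y|)} τ(z)[x,y]`. -/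
def IsInducedBracket (G : ZMod 2 → Submodule K V) (br : V → V → V)
    (τ : V →ₗ[K] K) (brτ : V → V → V → V) : Prop :=
  IsTrilinear K brτ ∧
  ∀ (i j k : ZMod 2), ∀ x ∈ G i, ∀ y ∈ G j, ∀ z ∈ G k,
    brτ x y z = τ x • br y z - (sg K (i * j) * τ y) • br x z
      + (sg K (k * (i + j)) * τ z) • br x y

/-- The Rota-Baxter identity of weight `lam` for a binary bracket. -/
def IsRotaBaxter₂ (br : V → V → V) (lam : K) (R : Module.End K V) : Prop :=
  ∀ x y : V, br (R x) (R y) = R (br (R x) y + br x (R y) + lam • br x y)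

/-- The Rota-Baxter identity of weight `lam` for a ternary bracket. -/
def IsRotaBaxter₃ (br : V → V → V → V) (lam : K) (R : Module.End K V) : Prop :=
  ∀ x y z : V,
    br (R x) (R y) (R z)
      = R (br (R x) (R y) z + br (R x) y (R z) + br x (R y) (R z)
          + lam • br (R x) y z + lam • br x (R y) z + lam • br x y (R z)
          + lam ^ 2 • br x y z)

/-- The Nijenhuis identity for a binary bracket. -/
def IsNijenhuis₂ (br : V → V → V) (N : Module.End K V) : Prop :=
  ∀ x y : V, br (N x) (N y) = N (br (N x) y + br x (N y) - N (br x y))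

/-- The Nijenhuis identity for a ternary bracket. -/
def IsNijenhuis₃ (br : V → V → V → V) (N : Module.End K V) : Prop :=
  ∀ x y z : V,
    br (N x) (N y) (N z)
      = N (br (N x) (N y) z + br (N x) y (N z) + br x (N y) (N z))
        - N (N (br (N x) y z + br x (N y) z + br x y (N z)))
        + N (N (N (br x y z)))

/-- `D` is an `(α^s, β^r)`-derivation of degree `d` of the binary bracket `br`. -/
def IsAlphaBetaDeriv₂ (G : ZMod 2 → Submodule K V) (br : V → V → V)
    (α β : Module.End K V) (s r : ℕ) (d : ZMod 2) (D : Module.End K V) : Prop :=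
  D * α = α * D ∧ D * β = β * D ∧
  ∀ (i j : ZMod 2), ∀ x ∈ G i, ∀ y ∈ G j,
    D (br x y) = br (D x) ((α ^ s * β ^ r) y)
      + sg K (i * d) • br ((α ^ s * β ^ r) x) (D y)

/-- `D` is an `(α^s, β^r)`-derivation of degree `d` of the ternary bracket `br`. -/
def IsAlphaBetaDeriv₃ (G : ZMod 2 → Submodule K V) (br : V → V → V → V)
    (α β : Module.End K V) (s r : ℕ) (d : ZMod 2) (D : Module.End K V) : Prop :=
  D * α = α * D ∧ D * β = β * D ∧
  ∀ (i j k : ZMod 2), ∀ x ∈ G i, ∀ y ∈ G j, ∀ z ∈ G k,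
    D (br x y z) = br (D x) ((α ^ s * β ^ r) y) ((α ^ s * β ^ r) z)
      + sg K (i * d) • br ((α ^ s * β ^ r) x) (D y) ((α ^ s * β ^ r) z)
      + sg K (d * (i + j)) • br ((α ^ s * β ^ r) x) ((α ^ s * β ^ r) y) (D z)

/-- An even super-skewsymmetric trilinear map with respect to the grading `G`
and the structure maps `α`, `β`. -/
structure IsEvenSkewTrilinear (G : ZMod 2 → Submodule K V)
    (α β : Module.End K V) (f : V → V → V → V) : Prop where
  trilinear : IsTrilinear K f
  even : ∀ (i j k : ZMod 2), ∀ x ∈ G i, ∀ y ∈ G j, ∀ z ∈ G k, f x y z ∈ G (i + j + k)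
  skew₁ : ∀ (i j k : ZMod 2), ∀ x ∈ G i, ∀ y ∈ G j, ∀ z ∈ G k,
    f (β x) (β y) (α z) = - sg K (i * j) • f (β y) (β x) (α z)
  skew₂ : ∀ (i j k : ZMod 2), ∀ x ∈ G i, ∀ y ∈ G j, ∀ z ∈ G k,
    f (β x) (β y) (α z) = - sg K (j * k) • f (β x) (β z) (α y)

/-- The composition `(f ∘_{α,β} g)(x₁∧x₂, y₁∧y₂, z)` of two trilinear maps,
for homogeneous `x₁, x₂, y₁, y₂` of degrees `a, b, c, d`. -/
def circ (α β : Module.End K V) (f g : V → V → V → V)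
    (a b c d : ZMod 2) (x₁ x₂ y₁ y₂ z : V) : V :=
  f (g (β x₁) (β x₂) (α y₁)) (β (β y₂)) (β (β z))
    + sg K (c * (a + b)) • f (β (β y₁)) (g (β x₁) (β x₂) (α y₂)) (β (β z))
    - f (β (β x₁)) (β (β x₂)) (g (β y₁) (β y₂) (α z))
    + sg K ((a + b) * (c + d)) • f (β (β y₁)) (β (β y₂)) (g (β x₁) (β x₂) (α z))


theorem sg_mul_self (a : ZMod 2) : sg K a * sg K a = 1 := by
  unfold sg
  split_ifs <;> ring

theorem sg_add (a b : ZMod 2) : sg K (a + b) = sg K a * sg K b := by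
  have key : ∀ c : ZMod 2, c = 0 ∨ c = 1 := by decide
  have two : (1 + 1 : ZMod 2) = 0 := by decide
  rcases key a with rfl | rfl <;> rcases key b with rfl | rfl <;> simp [sg, two]

/-- Even maps are closed under products of powers. -/
theorem IsEvenMap.pow_mul_pow {K : Type*} [Field K] [Module K V] {G : ZMod 2 → Submodule K V}
    {α β : Module.End K V}
    (hα : IsEvenMap K G α) (hβ : IsEvenMap K G β) (s r : ℕ) :
    IsEvenMap K G (α ^ s * β ^ r) := by
  have key : ∀ {φ : Module.End K V}, IsEvenMap K G φ → ∀ n : ℕ, IsEvenMap K G (φ ^ n) := by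
    intro φ hφ n
    induction n with
    | zero => exact fun i x hx => by simpa using hx
    | succ n ih => exact fun i x hx => by simpa [pow_succ] using ih i _ (hφ i x hx)
  exact fun i x hx => key hα s i _ (key hβ r i x hx)

/-- The supercommutator of an `(α^s, β^r)`-derivation and an
`(α^{s'}, β^{r'})`-derivation of a 3-BiHom-Lie superalgebra is an
`(α^{s+s'}, β^{r+r'})`-derivation. -/
theorem supercommutator_deriv {K V : Type*} [Field K] [AddCommGroup V] [Module K V]
    (G : ZMod 2 → Submodule K V)
    (br : V → V → V → V) (α β : Module.End K V)
    (h : Is3BiHomLieSuperalgebra K G br α β)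
    (s r s' r' : ℕ) (d d' : ZMod 2) (D D' : Module.End K V)
    (hDhom : IsHomogeneousMap K G d D) (hD'hom : IsHomogeneousMap K G d' D')
    (hD : IsAlphaBetaDeriv₃ K G br α β s r d D)
    (hD' : IsAlphaBetaDeriv₃ K G br α β s' r' d' D') :
    IsAlphaBetaDeriv₃ K G br α β (s + s') (r + r') (d + d')
      (D * D' - sg K (d * d') • (D' * D)) := by
  obtain ⟨hDα, hDβ, hDbr⟩ := hD
  obtain ⟨hD'α, hD'β, hD'br⟩ := hD'
  have cα : Commute D α := hDα
  have cβ : Commute D β := hDβ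
  have cα' : Commute D' α := hD'α
  have cβ' : Commute D' β := hD'β
  have cαβ : Commute α β := h.comm
  refine ⟨((cα.mul_left cα').sub_left ((cα'.mul_left cα).smul_left _)).eq,
    ((cβ.mul_left cβ').sub_left ((cβ'.mul_left cβ).smul_left _)).eq, ?_⟩
  have hpow : α ^ (s + s') * β ^ (r + r') = (α ^ s * β ^ r) * (α ^ s' * β ^ r') := by
    rw [pow_add, pow_add, mul_assoc, mul_assoc, ← mul_assoc (α ^ s') (β ^ r),
      (cαβ.pow_pow s' r).eq, mul_assoc]
  have hAB : Commute (α ^ s * β ^ r) (α ^ s' * β ^ r') :=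
    (((Commute.refl α).pow_pow s s').mul_right (cαβ.pow_pow s r')).mul_left
      ((cαβ.symm.pow_pow r s').mul_right ((Commute.refl β).pow_pow r r'))
  have hDB : Commute D (α ^ s' * β ^ r') := (cα.pow_right s').mul_right (cβ.pow_right r')
  have hD'A : Commute D' (α ^ s * β ^ r) := (cα'.pow_right s).mul_right (cβ'.pow_right r)
  have hA := IsEvenMap.pow_mul_pow h.alpha_even h.beta_even s r
  have hB := IsEvenMap.pow_mul_pow h.alpha_even h.beta_even s' r'
  rw [hpow]
  generalize α ^ s * β ^ r = A at *
  generalize α ^ s' * β ^ r' = B at *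
  have eAB : ∀ v, B (A v) = A (B v) := fun v => (LinearMap.congr_fun hAB.eq v).symm
  have eDB : ∀ v, D (B v) = B (D v) := LinearMap.congr_fun hDB.eq
  have eD'A : ∀ v, D' (A v) = A (D' v) := LinearMap.congr_fun hD'A.eq
  intro i j k x hx y hy z hz
  have tri := h.trilinear
  have sub₁ : ∀ u v y z : V, br (u - v) y z = br u y z - br v y z := fun u v y z => by
    rw [sub_eq_add_neg, ← neg_one_smul K v, tri.add₁, tri.smul₁]; module
  have sub₂ : ∀ x u v z : V, br x (u - v) z = br x u z - br x v z := fun x u v z => by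
    rw [sub_eq_add_neg, ← neg_one_smul K v, tri.add₂, tri.smul₂]; module
  have sub₃ : ∀ x y u v : V, br x y (u - v) = br x y u - br x y v := fun x y u v => by
    rw [sub_eq_add_neg, ← neg_one_smul K v, tri.add₃, tri.smul₃]; module
  simp only [LinearMap.sub_apply, LinearMap.smul_apply, Module.End.mul_apply, sub₁, sub₂, sub₃,
    tri.smul₁, tri.smul₂, tri.smul₃]
  rw [hDbr i j k x hx y hy z hz, hD'br i j k x hx y hy z hz]
  simp only [map_add, map_smul]
  rw [hDbr _ _ _ _ (hD'hom i x hx) _ (hB j y hy) _ (hB k z hz),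
    hDbr _ _ _ _ (hB i x hx) _ (hD'hom j y hy) _ (hB k z hz),
    hDbr _ _ _ _ (hB i x hx) _ (hB j y hy) _ (hD'hom k z hz),
    hD'br _ _ _ _ (hDhom i x hx) _ (hA j y hy) _ (hA k z hz),
    hD'br _ _ _ _ (hA i x hx) _ (hDhom j y hy) _ (hA k z hz),
    hD'br _ _ _ _ (hA i x hx) _ (hA j y hy) _ (hDhom k z hz)]
  simp only [eAB, eDB, eD'A, mul_add, add_mul, sg_add, mul_comm d i, mul_comm d j,
    mul_comm d' i, mul_comm d' j, mul_comm d' d]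
  have hsq := sg_mul_self K (d * d')
  match_scalars <;> grind

end BiHomLieSuper
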